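/- arXiv:1310.2167 — 4 statements merged into one kernel-verified Lean document; each statement's English description precedes it below -/
import Mathlib

section
/- For every fixed μ > 0, the quantity ψ_n(μ) is strictly increasing in the dimension n: for every integer n ≥ 2, ψ_n(μ) < ψ_{n+1}(μ). -/
noncomputable section

/-- `ψ_n(μ) = μ^ν / (2^ν Γ(ν+1) I_ν(μ))` with `ν = (n-2)/2`, where
`I_ν(x) = ∑_{m=0}^∞ (x/2)^{2m+ν}/(m! Γ(m+ν+1))` is the modified Bessel function of
the first kind.  Cancelling the factor `(μ/2)^ν` this reads
`ψ_n(μ) = (∑_{m=0}^∞ (μ²/4)^m Γ(ν+1)/(m! Γ(m+ν+1)))⁻¹`, with `ν + 1 = n/2`;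
in particular `ψ_n(0) = 1`. -/
noncomputable def psi (n : ℕ) (μ : ℝ) : ℝ :=
  (∑' m : ℕ, (μ ^ 2 / 4) ^ m *
      (Real.Gamma ((n : ℝ) / 2) / (m.factorial * Real.Gamma ((m : ℝ) + (n : ℝ) / 2))))⁻¹

lemma Gamma_div_Gamma_natCast_succ_add {a : ℝ} (ha : 0 < a) (m : ℕ) :
    Real.Gamma a / Real.Gamma (((m + 1 : ℕ) : ℝ) + a) =
      Real.Gamma a / Real.Gamma ((m : ℝ) + a) / ((m : ℝ) + a) := by
  have h : (0 : ℝ) < (m : ℝ) + a := by positivity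
  rw [show (((m + 1 : ℕ) : ℝ) + a) = ((m : ℝ) + a) + 1 by push_cast; ring,
    Real.Gamma_add_one h.ne', div_div, mul_comm]

lemma Gamma_div_Gamma_natCast_add_pos {a : ℝ} (ha : 0 < a) (m : ℕ) :
    0 < Real.Gamma a / Real.Gamma ((m : ℝ) + a) :=
  div_pos (Real.Gamma_pos_of_pos ha) (Real.Gamma_pos_of_pos (by positivity))

lemma Gamma_div_Gamma_natCast_add_le_one {a : ℝ} (ha : 1 ≤ a) (m : ℕ) :
    Real.Gamma a / Real.Gamma ((m : ℝ) + a) ≤ 1 := by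
  have ha0 : 0 < a := by linarith
  induction m with
  | zero => simp [(Real.Gamma_pos_of_pos ha0).ne']
  | succ k ih =>
    rw [Gamma_div_Gamma_natCast_succ_add ha0]
    have hk : (0 : ℝ) ≤ k := k.cast_nonneg
    exact div_le_one_of_le₀ (by linarith) (by linarith)

lemma Gamma_div_Gamma_natCast_add_anti {a b : ℝ} (ha : 0 < a) (hab : a ≤ b) (m : ℕ) :
    Real.Gamma b / Real.Gamma ((m : ℝ) + b) ≤ Real.Gamma a / Real.Gamma ((m : ℝ) + a) := by
  have hb : 0 < b := ha.trans_le hab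
  induction m with
  | zero => simp [(Real.Gamma_pos_of_pos ha).ne', (Real.Gamma_pos_of_pos hb).ne']
  | succ k ih =>
    rw [Gamma_div_Gamma_natCast_succ_add ha, Gamma_div_Gamma_natCast_succ_add hb]
    exact div_le_div₀ (Gamma_div_Gamma_natCast_add_pos ha k).le ih (by positivity) (by linarith)

lemma besselTerm_eq (x a : ℝ) (m : ℕ) :
    x ^ m * (Real.Gamma a / (m.factorial * Real.Gamma ((m : ℝ) + a))) =
      x ^ m / m.factorial * (Real.Gamma a / Real.Gamma ((m : ℝ) + a)) := by
  rw [div_mul_div_comm, mul_div_assoc]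

lemma besselTerm_pos {x a : ℝ} (hx : 0 < x) (ha : 0 < a) (m : ℕ) :
    0 < x ^ m * (Real.Gamma a / (m.factorial * Real.Gamma ((m : ℝ) + a))) := by
  rw [besselTerm_eq]
  exact mul_pos (by positivity) (Gamma_div_Gamma_natCast_add_pos ha m)

lemma summable_besselTerm {x a : ℝ} (hx : 0 < x) (ha : 1 ≤ a) :
    Summable fun m : ℕ ↦
      x ^ m * (Real.Gamma a / (m.factorial * Real.Gamma ((m : ℝ) + a))) := by
  refine (Real.summable_pow_div_factorial x).of_nonneg_of_le
    (fun m ↦ (besselTerm_pos hx (by linarith) m).le) fun m ↦ ?_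
  rw [besselTerm_eq]
  exact mul_le_of_le_one_right (by positivity) (Gamma_div_Gamma_natCast_add_le_one ha m)

lemma tsum_besselTerm_strictAnti {x a b : ℝ} (hx : 0 < x) (ha : 1 ≤ a) (hab : a < b) :
    ∑' m : ℕ, x ^ m * (Real.Gamma b / (m.factorial * Real.Gamma ((m : ℝ) + b))) <
      ∑' m : ℕ, x ^ m * (Real.Gamma a / (m.factorial * Real.Gamma ((m : ℝ) + a))) := by
  have ha0 : 0 < a := by linarith
  have hb0 : 0 < b := by linarith
  refine Summable.tsum_lt_tsum (i := 1) (fun m ↦ ?_) ?_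
    (summable_besselTerm hx (ha.trans hab.le)) (summable_besselTerm hx ha)
  · rw [besselTerm_eq, besselTerm_eq]
    exact mul_le_mul_of_nonneg_left (Gamma_div_Gamma_natCast_add_anti ha0 hab.le m)
      (by positivity)
  · rw [besselTerm_eq, besselTerm_eq]
    refine mul_lt_mul_of_pos_left ?_ (by positivity)
    have h (c : ℝ) (hc : 0 < c) : Real.Gamma c / Real.Gamma (((1 : ℕ) : ℝ) + c) = c⁻¹ := by
      have := Gamma_div_Gamma_natCast_succ_add hc 0
      simpa [(Real.Gamma_pos_of_pos hc).ne'] using this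
    rw [h a ha0, h b hb0]
    exact inv_strictAnti₀ ha0 hab

/-- For every fixed `μ > 0`, the quantity `ψ_n(μ)` is strictly increasing in the
dimension `n`: for every integer `n ≥ 2`, `ψ_n(μ) < ψ_{n+1}(μ)`. -/
theorem psi_strictMono_dim (μ : ℝ) (hμ : 0 < μ) (n : ℕ) (hn : 2 ≤ n) :
    psi n μ < psi (n + 1) μ := by
  have hn' : (2 : ℝ) ≤ n := by exact_mod_cast hn
  have hx : 0 < μ ^ 2 / 4 := by positivity
  have ha : 1 ≤ (n : ℝ) / 2 := by linarith
  have hab : (n : ℝ) / 2 < ((n + 1 : ℕ) : ℝ) / 2 := by push_cast; linarith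
  have hb : 1 ≤ ((n + 1 : ℕ) : ℝ) / 2 := ha.trans hab.le
  exact inv_strictAnti₀
    ((summable_besselTerm hx hb).tsum_pos (fun m ↦ (besselTerm_pos hx (by linarith) m).le) 0
      (besselTerm_pos hx (by linarith) 0))
    (tsum_besselTerm_strictAnti hx ha hab)

end
end

section
/- Let n ≥ 2, let D ⊆ ℝⁿ be open, let μ > 0, and let u : D → ℝ be μ-panharmonic. Then for every x ∈ D and r > 0 with the closed ball B̄(x,r) contained in D, u(x) = ψ_n(μr) · ∫_{∂B(x,r)} u(y) σ(x,r; dy). -/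
open Set MeasureTheory
open scoped ENNReal

noncomputable section


/-- Second derivative of `f` at `x` in direction `v`. -/
def secondDeriv {E : Type*} [NormedAddCommGroup E] [NormedSpace ℝ E]
    (f : E → ℝ) (x v : E) : ℝ :=
  fderiv ℝ (fun y => fderiv ℝ f y v) x v

/-- The Laplace operator on `ℝⁿ`: `Δf = ∑ i, ∂²f/∂xᵢ²`. -/
def laplacian {n : ℕ} (f : EuclideanSpace ℝ (Fin n) → ℝ) (x : EuclideanSpace ℝ (Fin n)) : ℝ :=
  ∑ i : Fin n, secondDeriv f x (EuclideanSpace.single i 1)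

/-- The Laplace operator on `ℝⁿ × ℝ ≅ ℝ^{n+1}`:
`ΔF = ∑ i, ∂²F/∂xᵢ² + ∂²F/∂t²`. -/
def laplacianProd {n : ℕ} (F : EuclideanSpace ℝ (Fin n) × ℝ → ℝ)
    (p : EuclideanSpace ℝ (Fin n) × ℝ) : ℝ :=
  (∑ i : Fin n, secondDeriv F p (EuclideanSpace.single i 1, (0 : ℝ))) +
    secondDeriv F p (0, 1)

/-- The uniform (normalized) probability measure `σ(x,r;·)` on the sphere
`∂B(x,r) ⊆ ℝⁿ`, obtained by normalizing the `(n-1)`-dimensional Hausdorff measure. -/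
def sphereUniform (n : ℕ) (x : EuclideanSpace ℝ (Fin n)) (r : ℝ) :
    MeasureTheory.Measure (EuclideanSpace ℝ (Fin n)) :=
  (μH[(n : ℝ) - 1] (Metric.sphere x r))⁻¹ • μH[(n : ℝ) - 1].restrict (Metric.sphere x r)

/-- A power series with coefficients bounded by those of an exponential can be differentiated
termwise. -/
theorem hasDerivAt_tsum_mul_pow {c : ℕ → ℝ} {C K : ℝ}
    (h : ∀ m, |c m| ≤ C * K ^ m / m.factorial) (s : ℝ) :
    HasDerivAt (fun s => ∑' m, c m * s ^ m) (∑' m : ℕ, ((m + 1) * c (m + 1)) * s ^ m) s := by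
  have hsucc : ∀ m : ℕ, |(m + 1) * c (m + 1)| ≤ C * K * K ^ m / m.factorial := by
    intro m
    rw [abs_mul, abs_of_pos (by positivity : (0 : ℝ) < m + 1)]
    refine (mul_le_mul_of_nonneg_left (h (m + 1)) (by positivity)).trans_eq ?_
    rw [Nat.factorial_succ]
    push_cast
    field_simp
    ring
  set R := |s| + 1
  have hbound : ∀ (m : ℕ) (y : ℝ), y ∈ Metric.ball (0 : ℝ) R →
      ‖((m + 1) * c (m + 1)) * y ^ m‖ ≤ C * K * ((K * R) ^ m / m.factorial) := by
    intro m y hy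
    rw [Metric.mem_ball, dist_zero_right] at hy
    rw [norm_mul, norm_pow, Real.norm_eq_abs]
    refine (mul_le_mul (hsucc m) (pow_le_pow_left₀ (norm_nonneg _) hy.le m) (by positivity)
      ((abs_nonneg _).trans (hsucc m))).trans_eq ?_
    rw [mul_pow]
    ring
  have hu : Summable fun m : ℕ => C * K * ((K * R) ^ m / m.factorial) :=
    (Real.summable_pow_div_factorial (K * R)).mul_left _
  let v : ℕ → ℝ := fun m => m.casesOn 0 fun m => C * K * ((K * R) ^ m / m.factorial)
  have hv : Summable v := (summable_nat_add_iff 1).1 hu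
  have hs : s ∈ Metric.ball (0 : ℝ) R := by
    simp [R]
  have key := hasDerivAt_tsum_of_isPreconnected (g := fun (m : ℕ) (y : ℝ) => c m * y ^ m)
    (g' := fun m y => c m * (m * y ^ (m - 1))) hv Metric.isOpen_ball
    (convex_ball (0 : ℝ) R).isPreconnected
    (fun m y _ => (hasDerivAt_pow m y).const_mul (c m))
    (fun m y hy => by
      cases m with
      | zero => simp [v]
      | succ m =>
        refine le_trans (le_of_eq ?_) (hbound m y hy)
        congr 1
        simp only [Nat.cast_succ, Nat.add_sub_cancel]
        ring)
    (Metric.mem_ball_self (by positivity : (0 : ℝ) < R))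
    (summable_of_ne_finset_zero (s := {0}) fun m hm => by
      have : m ≠ 0 := by simpa using hm
      simp [this]) hs
  refine key.congr_deriv ?_
  rw [Summable.tsum_eq_zero_add]
  · simp only [Nat.cast_zero, zero_mul, mul_zero, zero_add, Nat.add_sub_cancel]
    exact tsum_congr fun m => by push_cast; ring
  · refine (summable_nat_add_iff 1).1 (Summable.of_norm_bounded hu fun m => ?_)
    refine le_trans (le_of_eq ?_) (hbound m s hs)
    congr 1
    simp only [Nat.cast_succ, Nat.add_sub_cancel]
    ring

/-- The coefficients of the power series defining `psi n κ`. -/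
def psiCoeff (n : ℕ) (κ : ℝ) (m : ℕ) : ℝ :=
  (κ ^ 2 / 4) ^ m *
    (Real.Gamma ((n : ℝ) / 2) / (m.factorial * Real.Gamma ((m : ℝ) + (n : ℝ) / 2)))

theorem psiCoeff_nonneg (n : ℕ) (κ : ℝ) (m : ℕ) : 0 ≤ psiCoeff n κ m := by
  unfold psiCoeff
  have h1 : 0 ≤ Real.Gamma ((n : ℝ) / 2) := Real.Gamma_nonneg_of_nonneg (by positivity)
  have h2 : 0 ≤ Real.Gamma ((m : ℝ) + (n : ℝ) / 2) := Real.Gamma_nonneg_of_nonneg (by positivity)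
  positivity

theorem psiCoeff_zero {n : ℕ} (hn : n ≠ 0) (κ : ℝ) : psiCoeff n κ 0 = 1 := by
  have : Real.Gamma ((n : ℝ) / 2) ≠ 0 := (Real.Gamma_pos_of_pos (by positivity)).ne'
  simp [psiCoeff, this]

theorem psiCoeff_succ {n : ℕ} (hn : n ≠ 0) (κ : ℝ) (m : ℕ) :
    (m + 1) * (m + n / 2) * psiCoeff n κ (m + 1) = κ ^ 2 / 4 * psiCoeff n κ m := by
  have hpos : (0 : ℝ) < m + n / 2 := by positivity
  have hG : Real.Gamma ((m + 1 : ℕ) + (n : ℝ) / 2)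
      = (m + n / 2) * Real.Gamma ((m : ℝ) + (n : ℝ) / 2) := by
    rw [← Real.Gamma_add_one hpos.ne']
    push_cast
    ring_nf
  have := (Real.Gamma_pos_of_pos hpos).ne'
  have := hpos.ne'
  unfold psiCoeff
  rw [hG, Nat.factorial_succ]
  push_cast
  field_simp
  ring

theorem abs_psiCoeff_le {n : ℕ} (hn : 2 ≤ n) (κ : ℝ) (m : ℕ) :
    |psiCoeff n κ m| ≤ 1 * (κ ^ 2 / 4) ^ m / m.factorial := by
  rw [abs_of_nonneg (psiCoeff_nonneg n κ m)]
  induction m with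
  | zero => simp [psiCoeff_zero (by omega : n ≠ 0)]
  | succ m ih =>
    have h := psiCoeff_succ (by omega : n ≠ 0) κ m
    have hn' : (1 : ℝ) ≤ m + n / 2 := by
      have : (2 : ℝ) ≤ n := by exact_mod_cast hn
      have : (0 : ℝ) ≤ m := by positivity
      linarith
    have h1 : (m + 1) * psiCoeff n κ (m + 1) ≤ κ ^ 2 / 4 * psiCoeff n κ m := by
      rw [← h, mul_right_comm]
      exact le_mul_of_one_le_right (mul_nonneg (by positivity) (psiCoeff_nonneg _ _ _)) hn'
    have h2 : κ ^ 2 / 4 * psiCoeff n κ m ≤ κ ^ 2 / 4 * (1 * (κ ^ 2 / 4) ^ m / m.factorial) :=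
      mul_le_mul_of_nonneg_left ih (by positivity)
    rw [Nat.factorial_succ, le_div_iff₀ (by positivity)]
    push_cast
    calc psiCoeff n κ (m + 1) * ((m + 1) * m.factorial)
        = ((m + 1) * psiCoeff n κ (m + 1)) * m.factorial := by ring
      _ ≤ (κ ^ 2 / 4 * (1 * (κ ^ 2 / 4) ^ m / m.factorial)) * m.factorial := by
          exact mul_le_mul_of_nonneg_right (h1.trans h2) (by positivity)
      _ = 1 * (κ ^ 2 / 4) ^ (m + 1) := by
          field_simp
          ring

/-- The function `t ↦ 1 / psi n (κ t)` is a positive regular solution of the radial Yukawa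
equation. -/
theorem exists_radial_solution {n : ℕ} (hn : 2 ≤ n) (κ : ℝ) :
    ∃ N N' N'' : ℝ → ℝ, (∀ t, HasDerivAt N (N' t) t) ∧ (∀ t, HasDerivAt N' (N'' t) t) ∧
      (∀ t, t * N'' t + (n - 1) * N' t = κ ^ 2 * t * N t) ∧ (∀ t, 0 < N t) ∧
      N 0 = 1 ∧ psi n κ = (N 1)⁻¹ := by
  have hn0 : n ≠ 0 := by omega
  set c := psiCoeff n κ
  have hc := abs_psiCoeff_le hn κ
  let d : ℕ → ℝ := fun m => (m + 1) * c (m + 1)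
  have hd : ∀ m, |d m| ≤ κ ^ 2 / 4 * (κ ^ 2 / 4) ^ m / m.factorial := by
    intro m
    simp only [d]
    rw [abs_mul, abs_of_pos (by positivity : (0 : ℝ) < m + 1)]
    refine (mul_le_mul_of_nonneg_left (hc (m + 1)) (by positivity)).trans_eq ?_
    rw [Nat.factorial_succ]
    push_cast
    field_simp
    ring
  have he : ∀ m : ℕ, |(m + 1) * d (m + 1)| ≤
      (κ ^ 2 / 4) ^ 2 * (κ ^ 2 / 4) ^ m / m.factorial := by
    intro m
    rw [abs_mul, abs_of_pos (by positivity : (0 : ℝ) < m + 1)]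
    refine (mul_le_mul_of_nonneg_left (hd (m + 1)) (by positivity)).trans_eq ?_
    rw [Nat.factorial_succ]
    push_cast
    field_simp
    ring
  have summable_of_bound : ∀ (a : ℕ → ℝ) (C : ℝ),
      (∀ m, |a m| ≤ C * (κ ^ 2 / 4) ^ m / m.factorial) → ∀ s, Summable fun m => a m * s ^ m := by
    intro a C ha s
    refine Summable.of_norm_bounded
      ((Real.summable_pow_div_factorial (κ ^ 2 / 4 * |s|)).mul_left C) fun m => ?_
    rw [norm_mul, norm_pow, Real.norm_eq_abs, Real.norm_eq_abs]
    refine (mul_le_mul_of_nonneg_right (ha m) (by positivity)).trans_eq ?_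
    rw [mul_pow]
    ring
  set F : ℝ → ℝ := fun s => ∑' m, c m * s ^ m with hF
  set F' : ℝ → ℝ := fun s => ∑' m, d m * s ^ m with hF'
  set F'' : ℝ → ℝ := fun s => ∑' m : ℕ, ((m + 1) * d (m + 1)) * s ^ m with hF''
  have dF : ∀ s, HasDerivAt F (F' s) s := hasDerivAt_tsum_mul_pow hc
  have dF' : ∀ s, HasDerivAt F' (F'' s) s := hasDerivAt_tsum_mul_pow hd
  have ode : ∀ s, s * F'' s + n / 2 * F' s = κ ^ 2 / 4 * F s := by
    intro s
    have h2 : s * F'' s = ∑' m : ℕ, m * d m * s ^ m := by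
      rw [Summable.tsum_eq_zero_add, hF'', ← tsum_mul_left]
      · simp only [Nat.cast_zero, zero_mul, zero_add]
        exact tsum_congr fun m => by push_cast; ring
      · refine (summable_nat_add_iff 1).1
          (((summable_of_bound _ _ he s).mul_left s).congr fun m => ?_)
        push_cast
        ring
    have hsum : Summable fun m : ℕ => m * d m * s ^ m := by
      refine (summable_nat_add_iff 1).1
          (((summable_of_bound _ _ he s).mul_left s).congr fun m => ?_)
      push_cast
      ring
    rw [h2, hF', hF, ← tsum_mul_left, ← tsum_mul_left,
      ← hsum.tsum_add ((summable_of_bound _ _ hd s).mul_left _)]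
    refine tsum_congr fun m => ?_
    have := psiCoeff_succ hn0 κ m
    simp only [d]
    linear_combination s ^ m * this
  have hpos : ∀ s, 0 ≤ s → 0 < F s := by
    intro s hs
    refine (summable_of_bound _ _ hc s).tsum_pos
      (fun m => mul_nonneg (psiCoeff_nonneg n κ m) (by positivity)) 0 ?_
    simp [psiCoeff_zero hn0]
  have hsq : ∀ t : ℝ, HasDerivAt (fun t : ℝ => t ^ 2) (2 * t) t := fun t => by
    simpa using hasDerivAt_pow 2 t
  refine ⟨fun t => F (t ^ 2), fun t => F' (t ^ 2) * (2 * t),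
    fun t => F'' (t ^ 2) * (2 * t) * (2 * t) + F' (t ^ 2) * 2, fun t => ?_, fun t => ?_, fun t => ?_,
    fun t => hpos _ (sq_nonneg t), ?_, ?_⟩
  · exact (dF (t ^ 2)).comp t (hsq t)
  · have h2 : HasDerivAt (fun t : ℝ => 2 * t) 2 t := by
      simpa using (hasDerivAt_id t).const_mul 2
    exact ((dF' (t ^ 2)).comp t (hsq t)).mul h2
  · linear_combination 4 * t * ode (t ^ 2)
  · simp only [hF]
    rw [tsum_eq_single 0 fun m hm => by simp [hm]]
    simp [c, psiCoeff_zero hn0]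
  · simp [psi, hF, c, psiCoeff]

/-- Regular solutions of the radial Yukawa equation are proportional. -/
theorem radial_solution_unique {k : ℕ} {κ : ℝ} {M M' M'' N N' N'' : ℝ → ℝ}
    (hM : ∀ t, HasDerivAt M (M' t) t) (hM' : ∀ t, HasDerivAt M' (M'' t) t)
    (hN : ∀ t, HasDerivAt N (N' t) t) (hN' : ∀ t, HasDerivAt N' (N'' t) t)
    (odeM : ∀ t ∈ Icc (0 : ℝ) 1, t * M'' t + (k + 1) * M' t = κ ^ 2 * t * M t)
    (odeN : ∀ t ∈ Icc (0 : ℝ) 1, t * N'' t + (k + 1) * N' t = κ ^ 2 * t * N t)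
    (hpos : ∀ t, 0 < N t) (h0 : N 0 = 1) :
    M 1 = M 0 * N 1 := by
  have dW : ∀ t, HasDerivAt (fun t => t ^ (k + 1) * (M' t * N t - M t * N' t))
      ((k + 1) * t ^ k * (M' t * N t - M t * N' t) +
        t ^ (k + 1) * ((M'' t * N t + M' t * N' t) - (M' t * N' t + M t * N'' t))) t := by
    intro t
    have h := (hasDerivAt_pow (k + 1) t).mul (((hM' t).mul (hN t)).sub ((hM t).mul (hN' t)))
    refine h.congr_deriv ?_
    simp
  have hW : ∀ t ∈ Icc (0 : ℝ) 1, t ^ (k + 1) * (M' t * N t - M t * N' t) = 0 := by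
    intro t ht
    have h := constant_of_has_deriv_right_zero
      (f := fun t => t ^ (k + 1) * (M' t * N t - M t * N' t)) (a := 0) (b := 1)
      (fun s _ => (dW s).continuousAt.continuousWithinAt)
      (fun s hs => by
        have hs' : s ∈ Icc (0 : ℝ) 1 := Ico_subset_Icc_self hs
        refine ((dW s).congr_deriv ?_).hasDerivWithinAt
        linear_combination s ^ k * N s * odeM s hs' - s ^ k * M s * odeN s hs') t ht
    simpa using h
  have hW0 : ∀ t ∈ Icc (0 : ℝ) 1, M' t * N t - M t * N' t = 0 := by
    intro t ht
    rcases ht.1.eq_or_lt with h | h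
    · subst h
      have hm := odeM 0 ht
      have hn := odeN 0 ht
      have hk : (k + 1 : ℝ) ≠ 0 := by positivity
      have e1 : M' 0 = 0 := by simpa [hk] using hm
      have e2 : N' 0 = 0 := by simpa [hk] using hn
      simp [e1, e2]
    · exact (mul_eq_zero.1 (hW t ht)).resolve_left (by positivity)
  have h := constant_of_has_deriv_right_zero (f := fun t => M t / N t) (a := 0) (b := 1)
    (fun s _ => ((hM s).div (hN s) (hpos s).ne').continuousAt.continuousWithinAt)
    (fun s hs => by
      refine (((hM s).div (hN s) (hpos s).ne').congr_deriv ?_).hasDerivWithinAt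
      rw [hW0 s (Ico_subset_Icc_self hs), zero_div]) 1 (by simp)
  simp only [h0, div_one] at h
  rwa [div_eq_iff (hpos 1).ne'] at h

/-- Differentiation under the integral sign for a finite measure carried by a compact set. -/
theorem hasDerivAt_integral_of_isCompact {E : Type*} [NormedAddCommGroup E] [MeasurableSpace E]
    [BorelSpace E] [SecondCountableTopology E] {σ : Measure E} [IsFiniteMeasure σ] {K : Set E}
    (hK : IsCompact K) (hσ : ∀ᵐ y ∂σ, y ∈ K) {Φ Φ' : ℝ → E → ℝ}
    (hΦ : ∀ t, Continuous (Φ t)) (hΦ' : Continuous fun p : ℝ × E => Φ' p.1 p.2)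
    (h : ∀ t y, HasDerivAt (fun t => Φ t y) (Φ' t y) t) (t : ℝ) :
    HasDerivAt (fun t => ∫ y, Φ t y ∂σ) (∫ y, Φ' t y ∂σ) t := by
  obtain ⟨C, hC⟩ := ((isCompact_closedBall t 1).prod hK).exists_bound_of_continuousOn
    hΦ'.continuousOn
  obtain ⟨C₀, hC₀⟩ := hK.exists_bound_of_continuousOn (hΦ t).continuousOn
  have hΦ't : Continuous (Φ' t) := hΦ'.comp (by fun_prop : Continuous fun y : E => (t, y))
  refine (hasDerivAt_integral_of_dominated_loc_of_deriv_le (bound := fun _ => C)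
    (Metric.closedBall_mem_nhds t one_pos)
    (Filter.Eventually.of_forall fun s => (hΦ s).aestronglyMeasurable)
    (Integrable.of_bound (hΦ t).aestronglyMeasurable C₀ ?_) hΦ't.aestronglyMeasurable
    ?_ (integrable_const C) (Filter.Eventually.of_forall fun y s _ => h s y)).2
  · filter_upwards [hσ] with y hy using hC₀ y hy
  · filter_upwards [hσ] with y hy s hs using hC (s, y) ⟨hs, hy⟩

theorem integrable_of_isCompact {E : Type*} [NormedAddCommGroup E] [MeasurableSpace E]
    [BorelSpace E] [SecondCountableTopology E] {σ : Measure E} [IsFiniteMeasure σ] {K : Set E}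
    (hK : IsCompact K) (hσ : ∀ᵐ y ∂σ, y ∈ K) {f : E → ℝ} (hf : Continuous f) :
    Integrable f σ := by
  obtain ⟨C, hC⟩ := hK.exists_bound_of_continuousOn hf.continuousOn
  refine Integrable.of_bound hf.aestronglyMeasurable C ?_
  filter_upwards [hσ] with y hy using hC y hy

section Rotation

variable {n : ℕ}

/-- The generator of the rotations in the plane of the `i`-th and `j`-th coordinates. -/
def rotGen (i j : Fin n) (y : EuclideanSpace ℝ (Fin n)) : EuclideanSpace ℝ (Fin n) :=
  y i • EuclideanSpace.single j (1 : ℝ) - y j • EuclideanSpace.single i (1 : ℝ)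

/-- The rotation by the angle `θ` in the plane of the `i`-th and `j`-th coordinates, as a linear
map. -/
def rotLinear (i j : Fin n) (θ : ℝ) :
    EuclideanSpace ℝ (Fin n) →ₗ[ℝ] EuclideanSpace ℝ (Fin n) where
  toFun y := y + ((Real.cos θ - 1) * y i - Real.sin θ * y j) • EuclideanSpace.single i (1 : ℝ)
    + (Real.sin θ * y i + (Real.cos θ - 1) * y j) • EuclideanSpace.single j (1 : ℝ)
  map_add' y z := by
    ext l
    simp only [PiLp.add_apply, PiLp.smul_apply, smul_eq_mul]
    ring
  map_smul' c y := by
    ext l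
    simp only [PiLp.add_apply, PiLp.smul_apply, smul_eq_mul, RingHom.id_apply]
    ring

theorem norm_rotLinear {i j : Fin n} (hij : i ≠ j) (θ : ℝ) (y : EuclideanSpace ℝ (Fin n)) :
    ‖rotLinear i j θ y‖ = ‖y‖ := by
  rw [← sq_eq_sq₀ (norm_nonneg _) (norm_nonneg _), ← real_inner_self_eq_norm_sq,
    ← real_inner_self_eq_norm_sq]
  simp only [rotLinear, LinearMap.coe_mk, AddHom.coe_mk, inner_add_left, inner_add_right,
    inner_smul_left, inner_smul_right, EuclideanSpace.inner_single_left,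
    EuclideanSpace.inner_single_right, PiLp.single_apply, hij, hij.symm, if_true, if_false,
    map_one, conj_trivial]
  linear_combination (y i ^ 2 + y j ^ 2) * Real.sin_sq_add_cos_sq θ

/-- The rotation by the angle `θ` in the plane of the `i`-th and `j`-th coordinates. -/
def rot {i j : Fin n} (hij : i ≠ j) (θ : ℝ) :
    EuclideanSpace ℝ (Fin n) ≃ₗᵢ[ℝ] EuclideanSpace ℝ (Fin n) :=
  LinearIsometry.toLinearIsometryEquiv ⟨rotLinear i j θ, norm_rotLinear hij θ⟩ rfl

theorem rot_apply {i j : Fin n} (hij : i ≠ j) (θ : ℝ) (y : EuclideanSpace ℝ (Fin n)) :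
    rot hij θ y =
      y + ((Real.cos θ - 1) * y i - Real.sin θ * y j) • EuclideanSpace.single i (1 : ℝ)
      + (Real.sin θ * y i + (Real.cos θ - 1) * y j) • EuclideanSpace.single j (1 : ℝ) :=
  rfl

theorem hasDerivAt_rot {i j : Fin n} (hij : i ≠ j) (θ : ℝ) (y : EuclideanSpace ℝ (Fin n)) :
    HasDerivAt (fun θ => rot hij θ y)
      ((-Real.sin θ * y i - Real.cos θ * y j) • EuclideanSpace.single i (1 : ℝ)
        + (Real.cos θ * y i + -Real.sin θ * y j) • EuclideanSpace.single j (1 : ℝ)) θ := by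
  simp only [rot_apply]
  have hc := (Real.hasDerivAt_cos θ).sub_const 1
  have hs := Real.hasDerivAt_sin θ
  exact ((((hc.mul_const (y i)).sub (hs.mul_const (y j))).smul_const _).const_add y).add
    (((hs.mul_const (y i)).add (hc.mul_const (y j))).smul_const _)

/-- The derivative along a rotation field integrates to zero against a rotation invariant
measure. -/
theorem integral_fderiv_rotGen {σ : Measure (EuclideanSpace ℝ (Fin n))} [IsFiniteMeasure σ]
    {K : Set (EuclideanSpace ℝ (Fin n))} (hK : IsCompact K) (hσ : ∀ᵐ y ∂σ, y ∈ K)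
    (hinv : ∀ R : EuclideanSpace ℝ (Fin n) ≃ₗᵢ[ℝ] EuclideanSpace ℝ (Fin n), σ.map R = σ)
    {G : EuclideanSpace ℝ (Fin n) → ℝ} (hG : ContDiff ℝ 1 G) (i j : Fin n) :
    ∫ y, fderiv ℝ G y (rotGen i j y) ∂σ = 0 := by
  rcases eq_or_ne i j with rfl | hij
  · simp [rotGen]
  have hcont : Continuous fun p : ℝ × EuclideanSpace ℝ (Fin n) => rot hij p.1 p.2 := by
    simp only [rot_apply]
    fun_prop
  have h := hasDerivAt_integral_of_isCompact hK hσ (Φ := fun θ y => G (rot hij θ y))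
    (Φ' := fun θ y => fderiv ℝ G (rot hij θ y)
      ((-Real.sin θ * y i - Real.cos θ * y j) • EuclideanSpace.single i (1 : ℝ)
        + (Real.cos θ * y i + -Real.sin θ * y j) • EuclideanSpace.single j (1 : ℝ)))
    (fun θ => hG.continuous.comp (rot hij θ).continuous)
    (((hG.continuous_fderiv one_ne_zero).comp hcont).clm_apply (by fun_prop))
    (fun θ y => ((hG.differentiable one_ne_zero _).hasFDerivAt.comp_hasDerivAt θ
      (hasDerivAt_rot hij θ y))) 0
  have hconst : (fun θ => ∫ y, G (rot hij θ y) ∂σ) = fun _ => ∫ y, G y ∂σ := by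
    funext θ
    conv_rhs => rw [← hinv (rot hij θ)]
    rw [integral_map (rot hij θ).continuous.aemeasurable hG.continuous.aestronglyMeasurable]
  rw [hconst] at h
  rw [← h.unique (hasDerivAt_const 0 _)]
  refine integral_congr_ae (Filter.Eventually.of_forall fun y => ?_)
  have h0 : rot hij 0 y = y := by simp [rot_apply]
  simp only [h0, Real.sin_zero, Real.cos_zero, rotGen]
  congr 1
  simp only [neg_zero, zero_mul, one_mul, zero_sub, add_zero, neg_smul]
  abel

theorem rotGen_rotGen (i j : Fin n) (y : EuclideanSpace ℝ (Fin n)) :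
    rotGen i j (rotGen i j y) =
      ((if i = j then y i else 0) - y j) • EuclideanSpace.single j (1 : ℝ)
      + ((if i = j then y j else 0) - y i) • EuclideanSpace.single i (1 : ℝ) := by
  rcases eq_or_ne i j with rfl | hij
  · simp [rotGen]
  · simp [rotGen, hij, hij.symm, sub_eq_add_neg]

theorem sum_smul_single (y : EuclideanSpace ℝ (Fin n)) :
    ∑ i, y i • EuclideanSpace.single i (1 : ℝ) = y := by
  simpa using (EuclideanSpace.basisFun (Fin n) ℝ).sum_repr y

theorem sum_rotGen_rotGen (y : EuclideanSpace ℝ (Fin n)) :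
    ∑ i, ∑ j, rotGen i j (rotGen i j y) = -(2 * ((n : ℝ) - 1)) • y := by
  have h1 : ∑ i : Fin n, ∑ j : Fin n,
      ((if i = j then y i else 0) - y j) • EuclideanSpace.single j (1 : ℝ) = (1 - n : ℝ) • y := by
    simp only [sub_smul, Finset.sum_sub_distrib, ite_smul, zero_smul, Finset.sum_ite_eq,
      Finset.mem_univ, if_true, sum_smul_single, Finset.sum_const, Finset.card_univ,
      Fintype.card_fin, one_smul]
    rw [← Nat.cast_smul_eq_nsmul ℝ]
  have h2 : ∑ i : Fin n, ∑ j : Fin n,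
      ((if i = j then y j else 0) - y i) • EuclideanSpace.single i (1 : ℝ) = (1 - n : ℝ) • y := by
    rw [Finset.sum_comm, ← h1]
    simp only [eq_comm]
  simp only [rotGen_rotGen, Finset.sum_add_distrib, h1, h2]
  rw [← add_smul]
  congr 1
  ring

/-- The quadratic part of the decomposition of the Laplacian into radial and angular parts. -/
theorem sum_bilin_rotGen (B : EuclideanSpace ℝ (Fin n) →L[ℝ] EuclideanSpace ℝ (Fin n) →L[ℝ] ℝ)
    (y : EuclideanSpace ℝ (Fin n)) :
    ∑ i, ∑ j, B (rotGen i j y) (rotGen i j y) =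
      2 * (‖y‖ ^ 2 * ∑ i, B (EuclideanSpace.single i 1) (EuclideanSpace.single i 1) - B y y) := by
  have hB : B y y = ∑ i, ∑ j, y i * y j *
      B (EuclideanSpace.single i 1) (EuclideanSpace.single j 1) := by
    conv_lhs => rw [← sum_smul_single y]
    simp only [map_sum, sum_apply, map_smul, smul_apply,
      smul_eq_mul, Finset.mul_sum]
    rw [Finset.sum_comm]
    refine Finset.sum_congr rfl fun i _ => Finset.sum_congr rfl fun j _ => by ring
  have hB' : B y y = ∑ i, ∑ j, y i * y j *
      B (EuclideanSpace.single j 1) (EuclideanSpace.single i 1) := by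
    rw [hB, Finset.sum_comm]
    refine Finset.sum_congr rfl fun i _ => Finset.sum_congr rfl fun j _ => by ring
  have hL : ‖y‖ ^ 2 * ∑ i, B (EuclideanSpace.single i 1) (EuclideanSpace.single i 1) =
      ∑ i, ∑ j, y i ^ 2 * B (EuclideanSpace.single j 1) (EuclideanSpace.single j 1) := by
    rw [EuclideanSpace.real_norm_sq_eq, Finset.sum_mul_sum]
  have hL' : ‖y‖ ^ 2 * ∑ i, B (EuclideanSpace.single i 1) (EuclideanSpace.single i 1) =
      ∑ i, ∑ j, y j ^ 2 * B (EuclideanSpace.single i 1) (EuclideanSpace.single i 1) := by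
    rw [hL, Finset.sum_comm]
  have : ∀ i j : Fin n, B (rotGen i j y) (rotGen i j y) =
      (y i ^ 2 * B (EuclideanSpace.single j 1) (EuclideanSpace.single j 1)
        + y j ^ 2 * B (EuclideanSpace.single i 1) (EuclideanSpace.single i 1))
      - (y i * y j * B (EuclideanSpace.single i 1) (EuclideanSpace.single j 1)
        + y i * y j * B (EuclideanSpace.single j 1) (EuclideanSpace.single i 1)) := by
    intro i j
    simp only [rotGen, map_sub, map_smul, sub_apply,
      smul_apply, smul_eq_mul]
    ring
  simp only [this, Finset.sum_sub_distrib, Finset.sum_add_distrib]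
  rw [← hL, ← hL', ← hB, ← hB']
  ring

end Rotation

theorem laplacian_eq_sum_fderiv_fderiv {n : ℕ} {u : EuclideanSpace ℝ (Fin n) → ℝ}
    (hu : ContDiff ℝ 2 u) (x : EuclideanSpace ℝ (Fin n)) :
    laplacian u x = ∑ i, fderiv ℝ (fderiv ℝ u) x (EuclideanSpace.single i 1)
      (EuclideanSpace.single i 1) := by
  have hd : ContDiff ℝ 1 (fderiv ℝ u) := hu.fderiv_right (by norm_num)
  refine Finset.sum_congr rfl fun i _ => ?_
  unfold secondDeriv
  rw [(((hd.differentiable one_ne_zero x).hasFDerivAt).clm_apply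
    (hasFDerivAt_const (EuclideanSpace.single i (1 : ℝ)) x)).fderiv]
  simp

/-- The mean value property on a sphere centred at the origin, for any rotation invariant
probability measure carried by the sphere. -/
theorem panharmonic_average_of_invariant {n : ℕ} (hn : 2 ≤ n)
    {σ : Measure (EuclideanSpace ℝ (Fin n))} [IsProbabilityMeasure σ] {r : ℝ}
    (hσ : ∀ᵐ y ∂σ, y ∈ Metric.sphere (0 : EuclideanSpace ℝ (Fin n)) r)
    (hinv : ∀ R : EuclideanSpace ℝ (Fin n) ≃ₗᵢ[ℝ] EuclideanSpace ℝ (Fin n), σ.map R = σ)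
    {u : EuclideanSpace ℝ (Fin n) → ℝ} (hu : ContDiff ℝ 2 u) {μ : ℝ}
    (hY : ∀ y ∈ Metric.closedBall (0 : EuclideanSpace ℝ (Fin n)) r,
      laplacian u y = μ ^ 2 * u y) :
    u 0 = psi n (μ * r) * ∫ y, u y ∂σ := by
  have hK : IsCompact (Metric.sphere (0 : EuclideanSpace ℝ (Fin n)) r) := isCompact_sphere _ _
  have hd : ContDiff ℝ 1 (fderiv ℝ u) := hu.fderiv_right (by norm_num)
  have hdd : Continuous (fderiv ℝ (fderiv ℝ u)) := hd.continuous_fderiv one_ne_zero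
  have hu0 : Continuous u := hu.continuous
  have hd0 : Continuous (fderiv ℝ u) := hd.continuous
  have hline : ∀ (t : ℝ) (y : EuclideanSpace ℝ (Fin n)), HasDerivAt (fun t : ℝ => t • y) y t :=
    fun t y => by simpa using (hasDerivAt_id t).smul_const y
  have hM : ∀ t, HasDerivAt (fun t : ℝ => ∫ y, u (t • y) ∂σ) (∫ y, fderiv ℝ u (t • y) y ∂σ) t :=
    hasDerivAt_integral_of_isCompact hK hσ (fun t => by fun_prop) (by fun_prop)
      (fun t y => (hu.differentiable two_ne_zero _).hasFDerivAt.comp_hasDerivAt t (hline t y))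
  have hM' : ∀ t, HasDerivAt (fun t : ℝ => ∫ y, fderiv ℝ u (t • y) y ∂σ)
      (∫ y, fderiv ℝ (fderiv ℝ u) (t • y) y y ∂σ) t :=
    hasDerivAt_integral_of_isCompact hK hσ (fun t => by fun_prop) (by fun_prop)
      (fun t y => by
        simpa using ((hd.differentiable one_ne_zero _).hasFDerivAt.comp_hasDerivAt t
          (hline t y)).clm_apply (hasDerivAt_const t y))
  have hrot : ∀ (t : ℝ) (i j : Fin n),
      ∫ y, (t * fderiv ℝ (fderiv ℝ u) (t • y) (rotGen i j y) (rotGen i j y) +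
        fderiv ℝ u (t • y) (rotGen i j (rotGen i j y))) ∂σ = 0 := by
    intro t i j
    let L : EuclideanSpace ℝ (Fin n) →L[ℝ] EuclideanSpace ℝ (Fin n) :=
      (EuclideanSpace.proj i : EuclideanSpace ℝ (Fin n) →L[ℝ] ℝ).smulRight
        (EuclideanSpace.single j (1 : ℝ)) -
      (EuclideanSpace.proj j : EuclideanSpace ℝ (Fin n) →L[ℝ] ℝ).smulRight
        (EuclideanSpace.single i (1 : ℝ))
    have hL : ∀ y, rotGen i j y = L y := fun y => by simp [rotGen, L]
    have hG : ContDiff ℝ 1 fun y => fderiv ℝ u (t • y) (L y) :=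
      (hd.comp (contDiff_const_smul t)).clm_apply L.contDiff
    rw [← integral_fderiv_rotGen hK hσ hinv hG i j]
    refine integral_congr_ae (Filter.Eventually.of_forall fun y => ?_)
    have h1 : HasFDerivAt (fun y => fderiv ℝ u (t • y))
        ((fderiv ℝ (fderiv ℝ u) (t • y)).comp
          (t • ContinuousLinearMap.id ℝ (EuclideanSpace ℝ (Fin n)))) y :=
      (hd.differentiable one_ne_zero _).hasFDerivAt.comp y ((hasFDerivAt_id y).const_smul t)
    simp only [hL]
    rw [(h1.clm_apply L.hasFDerivAt).fderiv]
    simp [add_comm]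
  have hode : ∀ t ∈ Icc (0 : ℝ) 1,
      t * ∫ y, fderiv ℝ (fderiv ℝ u) (t • y) y y ∂σ + (n - 1) * ∫ y, fderiv ℝ u (t • y) y ∂σ =
        (μ * r) ^ 2 * t * ∫ y, u (t • y) ∂σ := by
    intro t ht
    have hcontr : ∀ i j : Fin n, Continuous (rotGen i j) := fun i j => by
      unfold rotGen
      fun_prop
    have hint : ∀ i j : Fin n, Integrable (fun y =>
        t * fderiv ℝ (fderiv ℝ u) (t • y) (rotGen i j y) (rotGen i j y) +
          fderiv ℝ u (t • y) (rotGen i j (rotGen i j y))) σ := fun i j => by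
      have := hcontr i j
      exact integrable_of_isCompact hK hσ (by fun_prop)
    have hsum : ∫ y, ∑ i, ∑ j,
        (t * fderiv ℝ (fderiv ℝ u) (t • y) (rotGen i j y) (rotGen i j y) +
          fderiv ℝ u (t • y) (rotGen i j (rotGen i j y))) ∂σ = 0 := by
      rw [integral_finsetSum _ fun i _ => integrable_finsetSum _ fun j _ => hint i j]
      refine Finset.sum_eq_zero fun i _ => ?_
      rw [integral_finsetSum _ fun j _ => hint i j]
      exact Finset.sum_eq_zero fun j _ => hrot t i j
    have hae : ∀ᵐ y ∂σ, ∑ i, ∑ j,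
        (t * fderiv ℝ (fderiv ℝ u) (t • y) (rotGen i j y) (rotGen i j y) +
          fderiv ℝ u (t • y) (rotGen i j (rotGen i j y))) =
        2 * ((μ * r) ^ 2 * t * u (t • y) - t * fderiv ℝ (fderiv ℝ u) (t • y) y y
          - (n - 1) * fderiv ℝ u (t • y) y) := by
      filter_upwards [hσ] with y hy
      have hy' : ‖y‖ = r := by simpa using hy
      have hmem : t • y ∈ Metric.closedBall (0 : EuclideanSpace ℝ (Fin n)) r := by
        rw [mem_closedBall_zero_iff, norm_smul, Real.norm_of_nonneg ht.1, hy']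
        exact mul_le_of_le_one_left (hy' ▸ norm_nonneg y) ht.2
      simp only [Finset.sum_add_distrib, ← Finset.mul_sum, ← map_sum]
      rw [sum_bilin_rotGen, ← laplacian_eq_sum_fderiv_fderiv hu, hY _ hmem, sum_rotGen_rotGen,
        map_smul, hy', smul_eq_mul]
      ring
    rw [integral_congr_ae hae, integral_const_mul] at hsum
    have i1 : Integrable (fun y => (μ * r) ^ 2 * t * u (t • y)) σ :=
      integrable_of_isCompact hK hσ (by fun_prop)
    have i2 : Integrable (fun y => t * fderiv ℝ (fderiv ℝ u) (t • y) y y) σ :=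
      integrable_of_isCompact hK hσ (by fun_prop)
    have i3 : Integrable (fun y => (n - 1 : ℝ) * fderiv ℝ u (t • y) y) σ :=
      integrable_of_isCompact hK hσ (by fun_prop)
    rw [integral_sub (by exact i1.sub i2) i3, integral_sub i1 i2, integral_const_mul, integral_const_mul,
      integral_const_mul] at hsum
    linarith
  obtain ⟨N, N', N'', hN, hN', odeN, hpos, hN0, hpsi⟩ := exists_radial_solution hn (μ * r)
  obtain ⟨k, rfl⟩ := Nat.exists_eq_add_of_le' hn
  have hk : ((k + 2 : ℕ) : ℝ) - 1 = k + 1 := by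
    push_cast
    ring
  rw [hk] at odeN hode
  have := radial_solution_unique hM hM' hN hN' hode (fun t _ => odeN t) hpos hN0
  simp only [one_smul, zero_smul, integral_const, probReal_univ] at this
  rw [hpsi, this, mul_comm (u 0), inv_mul_cancel_left₀ (hpos 1).ne']

/-- A `C²` function on a neighbourhood of a closed ball agrees near the ball with a globally `C²`
function. -/
theorem exists_contDiff_eventuallyEq {E : Type*} [NormedAddCommGroup E] [InnerProductSpace ℝ E]
    [FiniteDimensional ℝ E] {D : Set E} (hD : IsOpen D) {u : E → ℝ} (hu : ContDiffOn ℝ 2 u D)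
    {x : E} {r : ℝ} (hr : 0 < r) (hball : Metric.closedBall x r ⊆ D) :
    ∃ v : E → ℝ, ContDiff ℝ 2 v ∧ ∀ y ∈ Metric.closedBall x r, v =ᶠ[nhds y] u := by
  obtain ⟨δ, hδ, hsub⟩ := (isCompact_closedBall x r).exists_cthickening_subset_open hD hball
  rw [cthickening_closedBall hδ.le hr.le] at hsub
  let φ : ContDiffBump x := ⟨r + δ / 2, r + δ, by positivity, by linarith⟩
  refine ⟨fun y => φ y * u y, ?_, fun y hy => ?_⟩
  · rw [contDiff_iff_contDiffAt]
    intro y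
    by_cases hy : y ∈ D
    · exact φ.contDiff.contDiffAt.mul (hu.contDiffAt (hD.mem_nhds hy))
    · have hy' : y ∉ tsupport φ := fun h => hy (hsub (by
        rw [add_comm]
        rwa [φ.tsupport_eq] at h))
      have h0 : (fun y => φ y * u y) =ᶠ[nhds y] fun _ => 0 := by
        filter_upwards [notMem_tsupport_iff_eventuallyEq.1 hy'] with z hz
        simp [hz]
      exact contDiffAt_const.congr_of_eventuallyEq h0
  · have hy' : y ∈ Metric.ball x (r + δ / 2) :=
      Metric.closedBall_subset_ball (by linarith) hy
    filter_upwards [Metric.isOpen_ball.mem_nhds hy'] with z hz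
    rw [φ.one_of_mem_closedBall (Metric.ball_subset_closedBall hz), one_mul]

theorem laplacian_congr {n : ℕ} {u v : EuclideanSpace ℝ (Fin n) → ℝ}
    {x : EuclideanSpace ℝ (Fin n)} (h : u =ᶠ[nhds x] v) : laplacian u x = laplacian v x := by
  refine Finset.sum_congr rfl fun i _ => ?_
  have h' : (fun y => fderiv ℝ u y (EuclideanSpace.single i 1)) =ᶠ[nhds x]
      fun y => fderiv ℝ v y (EuclideanSpace.single i 1) := by
    filter_upwards [h.fderiv (𝕜 := ℝ)] with y hy
    rw [hy]
  simp only [secondDeriv, h'.fderiv_eq]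

theorem laplacian_comp_const_add {n : ℕ} (u : EuclideanSpace ℝ (Fin n) → ℝ)
    (x y : EuclideanSpace ℝ (Fin n)) :
    laplacian (fun z => u (x + z)) y = laplacian u (x + y) := by
  refine Finset.sum_congr rfl fun i _ => ?_
  simp only [secondDeriv, fderiv_comp_add_left]
  rw [fderiv_comp_add_left (f := fun z => fderiv ℝ u z (EuclideanSpace.single i 1))]

section Hausdorff

variable {k : ℕ}

theorem hausdorffMeasure_sphere_lt_top {r : ℝ} (hr : 0 < r) :
    μH[(k : ℝ)] (Metric.sphere (0 : EuclideanSpace ℝ (Fin (k + 1))) r) < ∞ := by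
  have hvol : (μH[(k : ℝ)] : Measure (Fin k → ℝ)) = volume := by
    simpa using hausdorffMeasure_pi_real (ι := Fin k)
  let v : Fin (k + 1) → ℝ → (Fin k → ℝ) → EuclideanSpace ℝ (Fin (k + 1)) := fun i s w =>
    s • EuclideanSpace.single i (1 : ℝ) + ∑ j, w j • EuclideanSpace.single (i.succAbove j) (1 : ℝ)
  have hvi : ∀ i s w, v i s w i = s := fun i s w => by
    simp [v, Fin.ne_succAbove]
  have hvj : ∀ i s w j, v i s w (i.succAbove j) = w j := fun i s w j => by
    simp [v, Fin.succAbove_ne, Pi.single_apply]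
  let f : Fin (k + 1) → ℝ → (Fin k → ℝ) → EuclideanSpace ℝ (Fin (k + 1)) := fun i s w =>
    r • (‖v i s w‖⁻¹ • v i s w)
  have hcover : Metric.sphere (0 : EuclideanSpace ℝ (Fin (k + 1))) r ⊆
      ⋃ p ∈ (Finset.univ : Finset (Fin (k + 1))) ×ˢ ({1, -1} : Finset ℝ),
        f p.1 p.2 '' Icc (-1) 1 := by
    intro z hz
    have hz' : ‖z‖ = r := by simpa using hz
    obtain ⟨i, hi⟩ := Finite.exists_max fun i => |z i|
    have hzi : 0 < |z i| := by
      refine lt_of_le_of_ne (abs_nonneg _) fun h => hr.ne ?_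
      have : z = 0 := by
        ext j
        exact abs_nonpos_iff.1 (h ▸ hi j)
      rw [← hz', this, norm_zero]
    have hv : v i (|z i|⁻¹ * z i) (fun j => |z i|⁻¹ * z (i.succAbove j)) = |z i|⁻¹ • z := by
      ext l
      rcases Fin.eq_self_or_eq_succAbove i l with rfl | ⟨j, rfl⟩
      · rw [hvi, PiLp.smul_apply, smul_eq_mul]
      · rw [hvj, PiLp.smul_apply, smul_eq_mul]
    refine mem_iUnion₂.2 ⟨(i, |z i|⁻¹ * z i), ?_, fun j => |z i|⁻¹ * z (i.succAbove j), ?_, ?_⟩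
    · simp only [Finset.mem_product, Finset.mem_univ, true_and, Finset.mem_insert,
        Finset.mem_singleton]
      rcases abs_choice (z i) with h | h
      · left
        rw [h] at hzi ⊢
        exact inv_mul_cancel₀ hzi.ne'
      · right
        rw [h] at hzi ⊢
        have : z i ≠ 0 := by linarith
        field_simp
    · have : ∀ j, |(|z i|⁻¹ * z (i.succAbove j))| ≤ 1 := fun j => by
        rw [abs_mul, abs_inv, abs_abs, inv_mul_le_one₀ hzi]
        exact hi _
      exact ⟨fun j => (abs_le.1 (this j)).1, fun j => (abs_le.1 (this j)).2⟩
    · simp only [f, hv, norm_smul, norm_inv, norm_abs_eq_norm, Real.norm_eq_abs, hz', smul_smul]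
      have : r * (|z i|⁻¹ * r)⁻¹ * |z i|⁻¹ = 1 := by
        field_simp
      rw [this, one_smul]
  refine (measure_mono hcover).trans_lt (measure_biUnion_lt_top (Finset.finite_toSet _) ?_)
  rintro ⟨i, s⟩ hs
  have hs0 : s ≠ 0 := by
    have : s = 1 ∨ s = -1 := by simpa using hs
    rcases this with rfl | rfl <;> norm_num
  have hv0 : ∀ w, v i s w ≠ 0 := fun w h => hs0 (by rw [← hvi i s w, h, PiLp.zero_apply])
  have hvc : ContDiff ℝ 1 (v i s) := by
    simp only [v]
    fun_prop
  have hfc : ContDiff ℝ 1 (f i s) :=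
    (((hvc.norm ℝ hv0).inv fun w => norm_ne_zero_iff.2 (hv0 w)).smul hvc).const_smul r
  obtain ⟨K, hK⟩ := hfc.contDiffOn.exists_lipschitzOnWith one_ne_zero
    (convex_Icc (-1 : Fin k → ℝ) 1) isCompact_Icc
  refine (hK.hausdorffMeasure_image_le k.cast_nonneg).trans_lt ?_
  rw [hvol]
  exact ENNReal.mul_lt_top (ENNReal.rpow_lt_top_of_nonneg k.cast_nonneg ENNReal.coe_ne_top)
    isCompact_Icc.measure_lt_top

theorem hausdorffMeasure_sphere_pos {r : ℝ} (hr : 0 < r) :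
    0 < μH[(k : ℝ)] (Metric.sphere (0 : EuclideanSpace ℝ (Fin (k + 1))) r) := by
  have hvol : (μH[(k : ℝ)] : Measure (Fin k → ℝ)) = volume := by
    simpa using hausdorffMeasure_pi_real (ι := Fin k)
  let p : EuclideanSpace ℝ (Fin (k + 1)) → Fin k → ℝ := fun y j => y j.succ
  have hp : LipschitzWith 1 p := LipschitzWith.mk_one fun y z =>
    (dist_pi_le_iff dist_nonneg).2 fun j => by
      rw [dist_eq_norm, dist_eq_norm]
      exact PiLp.norm_apply_le (y - z) j.succ
  have hsub : Metric.ball (0 : Fin k → ℝ) (r / (k + 1)) ⊆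
      p '' Metric.sphere (0 : EuclideanSpace ℝ (Fin (k + 1))) r := by
    intro w hw
    have hw' : ∀ j, |w j| ≤ r / (k + 1) := fun j =>
      (norm_le_pi_norm w j).trans (mem_ball_zero_iff.1 hw).le
    have hsum : ∑ j, w j ^ 2 ≤ r ^ 2 := by
      calc ∑ j, w j ^ 2 ≤ ∑ _j : Fin k, (r / (k + 1)) ^ 2 :=
            Finset.sum_le_sum fun j _ => sq_le_sq' (abs_le.1 (hw' j)).1 (abs_le.1 (hw' j)).2
        _ = r ^ 2 * (k / (k + 1) ^ 2) := by
            rw [Finset.sum_const, Finset.card_univ, Fintype.card_fin, nsmul_eq_mul, div_pow]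
            ring
        _ ≤ r ^ 2 := by
            refine mul_le_of_le_one_right (by positivity) ((div_le_one (by positivity)).2 ?_)
            nlinarith [(Nat.cast_nonneg k : (0 : ℝ) ≤ k)]
    refine ⟨WithLp.toLp 2 (Fin.cons (Real.sqrt (r ^ 2 - ∑ j, w j ^ 2)) w), ?_, ?_⟩
    · rw [mem_sphere_zero_iff_norm, ← sq_eq_sq₀ (norm_nonneg _) hr.le,
        EuclideanSpace.real_norm_sq_eq, Fin.sum_univ_succ]
      simp only [Fin.cons_zero, Fin.cons_succ]
      rw [Real.sq_sqrt (by linarith)]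
      ring
    · ext j
      simp [p]
  have h1 := hp.hausdorffMeasure_image_le k.cast_nonneg
    (Metric.sphere (0 : EuclideanSpace ℝ (Fin (k + 1))) r)
  rw [ENNReal.coe_one, ENNReal.one_rpow, one_mul] at h1
  refine lt_of_lt_of_le ?_ ((measure_mono hsub).trans h1)
  rw [hvol]
  exact Metric.measure_ball_pos _ _ (by positivity)

end Hausdorff

theorem map_sphereUniform {n : ℕ} (e : EuclideanSpace ℝ (Fin n) ≃ᵢ EuclideanSpace ℝ (Fin n))
    (x : EuclideanSpace ℝ (Fin n)) (r : ℝ) :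
    (sphereUniform n x r).map e = sphereUniform n (e x) r := by
  have hpre : e ⁻¹' Metric.sphere (e x) r = Metric.sphere x r := by
    rw [e.preimage_sphere, e.symm_apply_apply]
  have he := e.measurePreserving_hausdorffMeasure ((n : ℝ) - 1)
  have hS : MeasurableSet (Metric.sphere (e x) r) := Metric.isClosed_sphere.measurableSet
  unfold sphereUniform
  rw [Measure.map_smul, ← hpre, (he.restrict_preimage hS).map_eq,
    he.measure_preimage hS.nullMeasurableSet]

theorem isProbabilityMeasure_sphereUniform {n : ℕ} (hn : n ≠ 0) {r : ℝ} (hr : 0 < r) :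
    IsProbabilityMeasure (sphereUniform n 0 r) := by
  obtain ⟨k, rfl⟩ := Nat.exists_eq_succ_of_ne_zero hn
  have hk : ((k.succ : ℕ) : ℝ) - 1 = k := by
    push_cast
    ring
  constructor
  rw [sphereUniform, hk, Measure.smul_apply, Measure.restrict_apply_univ, smul_eq_mul]
  exact ENNReal.inv_mul_cancel (hausdorffMeasure_sphere_pos hr).ne'
    (hausdorffMeasure_sphere_lt_top hr).ne

theorem ae_mem_sphere_sphereUniform {n : ℕ} (x : EuclideanSpace ℝ (Fin n)) (r : ℝ) :
    ∀ᵐ y ∂(sphereUniform n x r), y ∈ Metric.sphere x r :=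
  Measure.ae_smul_measure (ae_restrict_mem Metric.isClosed_sphere.measurableSet) _

/-- **Average property for panharmonic functions.**  Let `D ⊆ ℝⁿ` (`n ≥ 2`) be open,
`μ > 0`, and let `u` be `μ`-panharmonic on `D` (twice continuously differentiable with
`Δu = μ²u` on `D`).  Then for every `x ∈ D` and `r > 0` with `B̄(x,r) ⊆ D`,
`u(x) = ψ_n(μr) ∫_{∂B(x,r)} u dσ`. -/
theorem panharmonic_average (n : ℕ) (hn : 2 ≤ n)
    (D : Set (EuclideanSpace ℝ (Fin n))) (hD : IsOpen D)
    (μ : ℝ) (hμ : 0 < μ)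
    (u : EuclideanSpace ℝ (Fin n) → ℝ)
    (hu : ContDiffOn ℝ 2 u D)
    (hYukawa : ∀ x ∈ D, laplacian u x = μ ^ 2 * u x) :
    ∀ (x : EuclideanSpace ℝ (Fin n)) (r : ℝ), x ∈ D → 0 < r →
      Metric.closedBall x r ⊆ D →
      u x = psi n (μ * r) * ∫ y, u y ∂(sphereUniform n x r) := by
  intro x r _ hr hball
  obtain ⟨v, hv, hvu⟩ := exists_contDiff_eventuallyEq hD hu hr hball
  have := isProbabilityMeasure_sphereUniform (by omega : n ≠ 0) hr
  have hinv : ∀ R : EuclideanSpace ℝ (Fin n) ≃ₗᵢ[ℝ] EuclideanSpace ℝ (Fin n),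
      (sphereUniform n 0 r).map R = sphereUniform n 0 r := fun R => by
    simpa using map_sphereUniform R.toIsometryEquiv 0 r
  have hY : ∀ y ∈ Metric.closedBall (0 : EuclideanSpace ℝ (Fin n)) r,
      laplacian (fun z => v (x + z)) y = μ ^ 2 * v (x + y) := by
    intro y hy
    have hy' : x + y ∈ Metric.closedBall x r := by
      simpa [dist_eq_norm] using hy
    rw [laplacian_comp_const_add, laplacian_congr (hvu _ hy'), (hvu _ hy').eq_of_nhds]
    exact hYukawa _ (hball hy')
  have key := panharmonic_average_of_invariant (u := fun z => v (x + z)) hn (ae_mem_sphere_sphereUniform 0 r) hinv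
    (hv.comp (contDiff_const.add contDiff_id)) hY
  have hmap : (sphereUniform n 0 r).map (fun z => x + z) = sphereUniform n x r := by
    have h := map_sphereUniform (IsometryEquiv.addLeft x) 0 r
    rwa [IsometryEquiv.addLeft_apply, add_zero] at h
  have hint : ∫ y, u y ∂(sphereUniform n x r) = ∫ y, v (x + y) ∂(sphereUniform n 0 r) := by
    rw [← integral_map (φ := fun z => x + z) (by fun_prop)
      hv.continuous.aestronglyMeasurable, hmap]
    refine integral_congr_ae ?_
    filter_upwards [ae_mem_sphere_sphereUniform x r] with y hy
    exact (hvu y (Metric.sphere_subset_closedBall hy)).eq_of_nhds.symm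
  rw [hint, ← key, add_zero]
  exact (hvu x (Metric.mem_closedBall_self hr.le)).eq_of_nhds.symm

end
end

section
/- (Liouville theorem for panharmonic functions.) Let n ≥ 2 and μ ≥ 0, and let u : ℝⁿ → ℝ be μ-panharmonic on the entire space ℝⁿ. If u is bounded, then u is constant. -/
open Set

noncomputable section


/-- Second-order necessary condition for a local maximum of a function of one variable. -/
theorem IsLocalMax.nonpos_of_hasDerivAt_deriv {f f' : ℝ → ℝ} {x c : ℝ} (hmax : IsLocalMax f x)
    (hf : ∀ t, HasDerivAt f (f' t) t) (hf' : HasDerivAt f' c x) : c ≤ 0 := by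
  by_contra! hc
  have hd : deriv f = f' := funext fun t => (hf t).deriv
  have hmin : IsLocalMin f x :=
    isLocalMin_of_deriv_deriv_pos (by rwa [hd, hf'.deriv]) hmax.deriv_eq_zero (hf x).continuousAt
  have hconst : f =ᶠ[nhds x] fun _ => f x := by
    filter_upwards [hmax, hmin] with t h₁ h₂ using le_antisymm h₁ h₂
  have hzero : deriv (deriv f) x = 0 := by
    rw [hconst.deriv.deriv_eq]
    simp
  rw [hd, hf'.deriv] at hzero
  exact hc.ne' hzero

section Lines

variable {E : Type*} [NormedAddCommGroup E] [NormedSpace ℝ E] {f : E → ℝ}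

theorem hasDerivAt_comp_line (hf : Differentiable ℝ f) (p v : E) (t : ℝ) :
    HasDerivAt (fun s : ℝ => f (p + s • v)) (fderiv ℝ f (p + t • v) v) t := by
  have hline : HasDerivAt (fun s : ℝ => p + s • v) v t := by
    simpa using ((hasDerivAt_id t).smul_const v).const_add p
  exact (hf _).hasFDerivAt.comp_hasDerivAt t hline

theorem hasDerivAt_fderiv_comp_line (hf : ContDiff ℝ 2 f) (p v : E) :
    HasDerivAt (fun s : ℝ => fderiv ℝ f (p + s • v) v) (secondDeriv f p v) 0 := by
  have hd : Differentiable ℝ (fun y => fderiv ℝ f y v) :=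
    ((hf.fderiv_right (m := 1) (by norm_num)).clm_apply contDiff_const).differentiable (by norm_num)
  simpa [secondDeriv] using hasDerivAt_comp_line hd p v 0

theorem secondDeriv_neg_fun (f : E → ℝ) (x v : E) :
    secondDeriv (fun y => -f y) x v = -secondDeriv f x v := by
  simp only [secondDeriv, fderiv_fun_neg, neg_apply]

theorem secondDeriv_neg_dir (f : E → ℝ) (x v : E) : secondDeriv f x (-v) = secondDeriv f x v := by
  simp only [secondDeriv, map_neg, fderiv_fun_neg, neg_apply, neg_neg]

/-- If the difference of `f` along two lines, corrected by a quadratic polynomial, has a local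
maximum, then the second derivatives of `f` along these lines are comparable. -/
theorem secondDeriv_sub_le_of_isLocalMax (hf : ContDiff ℝ 2 f) {p q v w : E} {b c : ℝ}
    (hmax : IsLocalMax (fun t : ℝ => f (p + t • v) - f (q + t • w) - (b * t + c * t ^ 2)) 0) :
    secondDeriv f p v - secondDeriv f q w ≤ 2 * c := by
  have hd : Differentiable ℝ f := hf.differentiable (by norm_num)
  have hpoly (t : ℝ) : HasDerivAt (fun t : ℝ => b * t + c * t ^ 2) (b + 2 * c * t) t := by
    refine (((hasDerivAt_id' t).const_mul b).fun_add
      ((hasDerivAt_pow 2 t).const_mul c)).congr_deriv ?_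
    push_cast
    ring
  have hpoly' : HasDerivAt (fun t : ℝ => b + 2 * c * t) (2 * c) 0 := by
    simpa using ((hasDerivAt_id (0 : ℝ)).const_mul (2 * c)).const_add b
  have := hmax.nonpos_of_hasDerivAt_deriv
    (fun t => ((hasDerivAt_comp_line hd p v t).sub (hasDerivAt_comp_line hd q w t)).sub (hpoly t))
    (((hasDerivAt_fderiv_comp_line hf p v).sub (hasDerivAt_fderiv_comp_line hf q w)).sub hpoly')
  linarith

end Lines

theorem laplacian_neg_fun {n : ℕ} (u : EuclideanSpace ℝ (Fin n) → ℝ)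
    (x : EuclideanSpace ℝ (Fin n)) : laplacian (fun y => -u y) x = -laplacian u x := by
  simp [laplacian, secondDeriv_neg_fun]

/-- Reflection of `ℝⁿ` in the hyperplane `xᵢ = a`. -/
def coordReflection {n : ℕ} (i : Fin n) (a : ℝ) (x : EuclideanSpace ℝ (Fin n)) :
    EuclideanSpace ℝ (Fin n) :=
  x + (2 * (a - x i)) • EuclideanSpace.single i 1

theorem continuous_coordReflection {n : ℕ} (i : Fin n) (a : ℝ) :
    Continuous (coordReflection i a) := by
  unfold coordReflection
  fun_prop

theorem coordReflection_add_smul_single {n : ℕ} (i j : Fin n) (a t : ℝ)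
    (x : EuclideanSpace ℝ (Fin n)) :
    coordReflection i a (x + t • EuclideanSpace.single j 1) =
      coordReflection i a x +
        t • (if j = i then -EuclideanSpace.single j 1 else EuclideanSpace.single j 1) := by
  unfold coordReflection
  split_ifs with h
  · subst h
    simp
    module
  · simp [Ne.symm h]
    module

theorem norm_add_smul_single_sq {n : ℕ} (p : EuclideanSpace ℝ (Fin n)) (j : Fin n) (t : ℝ) :
    ‖p + t • EuclideanSpace.single j (1 : ℝ)‖ ^ 2 = ‖p‖ ^ 2 + 2 * p j * t + t ^ 2 := by
  rw [norm_add_sq_real, inner_smul_right, norm_smul]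
  simp [EuclideanSpace.inner_single_right]
  ring

/-- The barrier on the slab `0 ≤ s ≤ R`: a concave parabola vanishing at `0`, equal to `2C` at
`R`. -/
def slabBarrier (C R s : ℝ) : ℝ := 2 * C * (2 * (s / R) - (s / R) ^ 2)

theorem slabBarrier_nonneg {C R s : ℝ} (hC : 0 ≤ C) (hR : 0 < R) (h0 : 0 ≤ s) (hs : s ≤ R) :
    0 ≤ slabBarrier C R s := by
  have h₁ : 0 ≤ s / R := by positivity
  have h₂ : s / R ≤ 1 := (div_le_one hR).2 hs
  unfold slabBarrier
  have : 0 ≤ 2 * (s / R) - (s / R) ^ 2 := by nlinarith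
  positivity

/-- A local maximum of `u x - u (σ x)` minus barrier and penalty, `σ` being a coordinate
reflection, cannot have `u (σ x) < u x` once the penalty is small. -/
theorem sub_coordReflection_nonpos_of_isLocalMax {n : ℕ} {μ : ℝ}
    {u : EuclideanSpace ℝ (Fin n) → ℝ} (hu : ContDiff ℝ 2 u)
    (hY : ∀ x, laplacian u x = μ ^ 2 * u x) {C R ε a : ℝ} {i : Fin n}
    (hε : n * ε < 2 * C / R ^ 2) {p : EuclideanSpace ℝ (Fin n)}
    (hmax : IsLocalMax (fun x => u x - u (coordReflection i a x) - slabBarrier C R (x i - a)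
      - ε * ‖x‖ ^ 2) p) :
    u p - u (coordReflection i a p) ≤ 0 := by
  set q := coordReflection i a p with hq
  have hdir (j : Fin n) :
      secondDeriv u p (EuclideanSpace.single j 1) - secondDeriv u q (EuclideanSpace.single j 1) ≤
        2 * (ε + if j = i then -(2 * C / R ^ 2) else 0) := by
    have hline : Continuous fun t : ℝ => p + t • EuclideanSpace.single j (1 : ℝ) := by fun_prop
    have hmax_line := IsLocalMax.comp_continuous (g := fun t : ℝ =>
      p + t • EuclideanSpace.single j (1 : ℝ)) (b := 0) (by simpa using hmax) hline.continuousAt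
    have hsecond : secondDeriv u q
        (if j = i then -EuclideanSpace.single j 1 else EuclideanSpace.single j 1) =
          secondDeriv u q (EuclideanSpace.single j 1) := by
      split_ifs
      · exact secondDeriv_neg_dir _ _ _
      · rfl
    rw [← hsecond]
    apply secondDeriv_sub_le_of_isLocalMax hu
      (b := 2 * ε * p j + if j = i then 4 * C / R - 4 * C * (p i - a) / R ^ 2 else 0)
    filter_upwards [hmax_line] with t ht
    simp only [Function.comp_apply, coordReflection_add_smul_single, norm_add_smul_single_sq,
      zero_smul, add_zero, ← hq] at ht ⊢
    by_cases h : j = i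
    · subst h
      simp [slabBarrier] at ht ⊢
      ring_nf at ht ⊢
      linarith
    · simp [h, Ne.symm h] at ht ⊢
      linarith
  have hsum := Finset.sum_le_sum fun j (_ : j ∈ Finset.univ) => hdir j
  have hlap : laplacian u p - laplacian u q ≤ 2 * (n * ε - 2 * C / R ^ 2) := by
    simpa [laplacian, ← Finset.mul_sum, Finset.sum_add_distrib, sub_eq_add_neg] using hsum
  rw [hY, hY, ← mul_sub] at hlap
  by_contra! h
  have := mul_nonneg (sq_nonneg μ) h.le
  linarith

/-- Comparison with the barrier on the slab `a ≤ xᵢ ≤ a + R`. -/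
theorem sub_coordReflection_le_slabBarrier {n : ℕ} {μ : ℝ}
    {u : EuclideanSpace ℝ (Fin n) → ℝ} (hu : ContDiff ℝ 2 u)
    (hY : ∀ x, laplacian u x = μ ^ 2 * u x) {C R a : ℝ} {i : Fin n}
    (hC : 0 < C) (hb : ∀ x, |u x| ≤ C) (hR : 0 < R) {x : EuclideanSpace ℝ (Fin n)}
    (hx0 : 0 ≤ x i - a) (hxR : x i - a ≤ R) :
    u x - u (coordReflection i a x) ≤ slabBarrier C R (x i - a) := by
  by_contra! hlt
  have hdiff (y z : EuclideanSpace ℝ (Fin n)) : u y - u z ≤ 2 * C := by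
    linarith [(abs_le.1 (hb y)).2, (abs_le.1 (hb z)).1]
  obtain ⟨ε, hε0, hεx, hεn⟩ : ∃ ε > 0, ε * ‖x‖ ^ 2 <
      u x - u (coordReflection i a x) - slabBarrier C R (x i - a) ∧ n * ε < 2 * C / R ^ 2 := by
    have hlim (c d : ℝ) (hd : 0 < d) : ∀ᶠ ε in nhdsWithin (0 : ℝ) (Ioi 0), c * ε < d :=
      nhdsWithin_le_nhds ((by fun_prop : Continuous fun ε : ℝ => c * ε).continuousAt.eventually_lt
        continuousAt_const (by simpa using hd))
    obtain ⟨ε, ⟨h₁, h₂⟩, h₃⟩ := ((hlim (‖x‖ ^ 2) _ (sub_pos.2 hlt)).and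
      (hlim n (2 * C / R ^ 2) (by positivity))).and self_mem_nhdsWithin |>.exists
    exact ⟨ε, h₃, by rwa [mul_comm], h₂⟩
  set H : EuclideanSpace ℝ (Fin n) → ℝ := fun y =>
    u y - u (coordReflection i a y) - slabBarrier C R (y i - a) - ε * ‖y‖ ^ 2 with hH
  have hHcont : Continuous H := by
    have := continuous_coordReflection i a
    have := hu.continuous
    unfold H slabBarrier
    fun_prop
  set K : Set (EuclideanSpace ℝ (Fin n)) :=
    {y | 0 ≤ y i - a ∧ y i - a ≤ R ∧ ε * ‖y‖ ^ 2 ≤ 2 * C} with hK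
  have hKclosed : IsClosed K := by
    simp only [hK, ofPred_and]
    exact (isClosed_le (by fun_prop) (by fun_prop)).inter
      ((isClosed_le (by fun_prop) (by fun_prop)).inter (isClosed_le (by fun_prop) (by fun_prop)))
  have hKbdd : Bornology.IsBounded K := by
    refine (Metric.isBounded_closedBall (x := 0) (r := √(2 * C / ε))).subset fun y hy => ?_
    rw [mem_closedBall_zero_iff]
    exact Real.le_sqrt_of_sq_le ((le_div_iff₀' hε0).2 hy.2.2)
  have hHx : 0 < H x := by simp only [hH]; linarith
  have hxK : x ∈ K := ⟨hx0, hxR, by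
    linarith [hdiff x (coordReflection i a x), slabBarrier_nonneg hC.le hR hx0 hxR]⟩
  obtain ⟨p, hpK, hpmax⟩ :=
    (Metric.isCompact_of_isClosed_isBounded hKclosed hKbdd).exists_isMaxOn ⟨x, hxK⟩
      hHcont.continuousOn
  have hHp : 0 < H p := hHx.trans_le (hpmax hxK)
  simp only [hH] at hHp
  have hbar := slabBarrier_nonneg hC.le hR hpK.1 hpK.2.1
  have hpen : 0 ≤ ε * ‖p‖ ^ 2 := by positivity
  have hpdiff := hdiff p (coordReflection i a p)
  have hp0 : 0 < p i - a := by
    refine hpK.1.lt_of_ne fun h => ?_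
    have hfix : coordReflection i a p = p := by
      simp [coordReflection, show a - p i = 0 by linarith]
    rw [hfix] at hHp
    linarith
  have hpR : p i - a < R := by
    refine hpK.2.1.lt_of_ne fun h => ?_
    have htop : slabBarrier C R (p i - a) = 2 * C := by
      rw [h, slabBarrier, div_self hR.ne']
      ring
    linarith
  have hpC : ε * ‖p‖ ^ 2 < 2 * C := by linarith
  have hnhds : K ∈ nhds p := by
    filter_upwards [(by fun_prop : Continuous fun y : EuclideanSpace ℝ (Fin n) =>
        y i - a).continuousAt.eventually (Ioo_mem_nhds hp0 hpR),
      (by fun_prop : Continuous fun y : EuclideanSpace ℝ (Fin n) =>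
        ε * ‖y‖ ^ 2).continuousAt.eventually (Iio_mem_nhds hpC)] with y h₁ h₂
    exact ⟨h₁.1.le, h₁.2.le, le_of_lt h₂⟩
  have := sub_coordReflection_nonpos_of_isLocalMax hu hY hεn (hpmax.isLocalMax hnhds)
  linarith

theorem le_coordReflection_of_bounded {n : ℕ} {μ : ℝ}
    {u : EuclideanSpace ℝ (Fin n) → ℝ} (hu : ContDiff ℝ 2 u)
    (hY : ∀ x, laplacian u x = μ ^ 2 * u x) {C : ℝ} (hC : 0 < C) (hb : ∀ x, |u x| ≤ C)
    {i : Fin n} {a : ℝ} {x : EuclideanSpace ℝ (Fin n)} (hx : a ≤ x i) :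
    u x ≤ u (coordReflection i a x) := by
  have hlim : Filter.Tendsto (fun R => slabBarrier C R (x i - a)) Filter.atTop (nhds 0) := by
    have h : Filter.Tendsto (fun R : ℝ => (x i - a) / R) Filter.atTop (nhds 0) :=
      Filter.tendsto_id.const_div_atTop _
    simpa [slabBarrier] using ((h.const_mul 2).sub (h.pow 2)).const_mul (2 * C)
  have hle : u x - u (coordReflection i a x) ≤ 0 := by
    refine ge_of_tendsto hlim ?_
    filter_upwards [Filter.eventually_gt_atTop 0, Filter.eventually_ge_atTop (x i - a)]
      with R hR hxR
    exact sub_coordReflection_le_slabBarrier hu hY hC hb hR (sub_nonneg.2 hx) hxR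
  linarith

/-- A bounded panharmonic function is invariant under coordinate reflections. -/
theorem eq_coordReflection_of_bounded {n : ℕ} {μ : ℝ}
    {u : EuclideanSpace ℝ (Fin n) → ℝ} (hu : ContDiff ℝ 2 u)
    (hY : ∀ x, laplacian u x = μ ^ 2 * u x) {C : ℝ} (hC : 0 < C) (hb : ∀ x, |u x| ≤ C)
    {i : Fin n} {a : ℝ} {x : EuclideanSpace ℝ (Fin n)} (hx : a ≤ x i) :
    u x = u (coordReflection i a x) := by
  refine le_antisymm (le_coordReflection_of_bounded hu hY hC hb hx) (neg_le_neg_iff.1 ?_)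
  exact le_coordReflection_of_bounded (u := fun y => -u y) hu.neg
    (fun y => by rw [laplacian_neg_fun, hY, mul_neg]) hC (fun y => by simpa using hb y) hx

/-- A bounded panharmonic function is invariant under coordinate translations. -/
theorem add_smul_single_eq_of_bounded {n : ℕ} {μ : ℝ}
    {u : EuclideanSpace ℝ (Fin n) → ℝ} (hu : ContDiff ℝ 2 u)
    (hY : ∀ x, laplacian u x = μ ^ 2 * u x) {C : ℝ} (hC : 0 < C) (hb : ∀ x, |u x| ≤ C)
    (i : Fin n) (t : ℝ) (x : EuclideanSpace ℝ (Fin n)) :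
    u (x + t • EuclideanSpace.single i 1) = u x := by
  have hnonneg (s : ℝ) (hs : 0 ≤ s) (y : EuclideanSpace ℝ (Fin n)) :
      u (y + s • EuclideanSpace.single i 1) = u y := by
    rw [eq_coordReflection_of_bounded hu hY hC hb (i := i) (a := y i + s / 2) (by simp; linarith)]
    congr 1
    simp [coordReflection]
    module
  rcases le_total 0 t with ht | ht
  · exact hnonneg t ht x
  · rw [← hnonneg (-t) (neg_nonneg.2 ht) (x + t • EuclideanSpace.single i 1)]
    congr 1
    module

/-- **Liouville theorem for panharmonic functions.**  Let `n ≥ 2` and `μ ≥ 0`, and let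
`u : ℝⁿ → ℝ` be `μ`-panharmonic on the entire space (twice continuously differentiable
with `Δu = μ²u` everywhere).  If `u` is bounded, then `u` is constant. -/
theorem liouville_panharmonic (n : ℕ) (hn : 2 ≤ n) (μ : ℝ) (hμ : 0 ≤ μ)
    (u : EuclideanSpace ℝ (Fin n) → ℝ)
    (hu : ContDiff ℝ 2 u)
    (hYukawa : ∀ x, laplacian u x = μ ^ 2 * u x)
    (hbdd : ∃ C : ℝ, ∀ x, |u x| ≤ C) :
    ∀ x y, u x = u y := by
  obtain ⟨C, hC⟩ := hbdd
  have hC' (x) : |u x| ≤ |C| + 1 := by linarith [hC x, le_abs_self C]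
  have htrans (s : Finset (Fin n)) (v x : EuclideanSpace ℝ (Fin n)) :
      u (x + ∑ i ∈ s, v i • EuclideanSpace.single i 1) = u x := by
    induction s using Finset.induction_on with
    | empty => simp
    | insert i s hi ih =>
      rw [Finset.sum_insert hi, add_comm (v i • _), ← add_assoc,
        add_smul_single_eq_of_bounded hu hYukawa (by positivity) hC', ih]
  intro x y
  rw [← htrans Finset.univ (x - y) y]
  congr 1
  ext j
  simp [Finset.sum_apply, Pi.single_apply]

end
end

section
/- Let n ≥ 2 and μ > 0, and let u : ℝⁿ → ℝ be a bounded continuous function satisfying the average property u(x) = ψ_n(μr) · ∫_{∂B(x,r)} u(y) σ(x,r; dy) for every x ∈ ℝⁿ and every r > 0. Then u is constant. -/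
open Set MeasureTheory
open scoped ENNReal

noncomputable section

lemma gamma_le_gamma_natCast_add {s : ℝ} (hs : 1 ≤ s) (m : ℕ) :
    Real.Gamma s ≤ Real.Gamma ((m : ℝ) + s) := by
  induction m with
  | zero => simp
  | succ k ih =>
    have hk : (1 : ℝ) ≤ (k : ℝ) + s := le_add_of_nonneg_of_le k.cast_nonneg hs
    have hrec : Real.Gamma (((k + 1 : ℕ) : ℝ) + s) = ((k : ℝ) + s) * Real.Gamma ((k : ℝ) + s) := by
      rw [← Real.Gamma_add_one (by linarith)]
      push_cast
      ring_nf
    rw [hrec]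
    exact ih.trans (le_mul_of_one_le_left (Real.Gamma_pos_of_pos (by linarith)).le hk)

lemma psi_term_nonneg (n : ℕ) (t : ℝ) (m : ℕ) :
    0 ≤ (t ^ 2 / 4) ^ m *
      (Real.Gamma ((n : ℝ) / 2) / (m.factorial * Real.Gamma ((m : ℝ) + (n : ℝ) / 2))) := by
  have h₁ := Real.Gamma_nonneg_of_nonneg (s := (n : ℝ) / 2) (by positivity)
  have h₂ := Real.Gamma_nonneg_of_nonneg (s := (m : ℝ) + (n : ℝ) / 2) (by positivity)
  positivity

lemma summable_psi_term {n : ℕ} (hn : 2 ≤ n) (t : ℝ) :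
    Summable fun m : ℕ ↦ (t ^ 2 / 4) ^ m *
      (Real.Gamma ((n : ℝ) / 2) / (m.factorial * Real.Gamma ((m : ℝ) + (n : ℝ) / 2))) := by
  refine Summable.of_nonneg_of_le (psi_term_nonneg n t) (fun m ↦ ?_)
    (Real.summable_pow_div_factorial (t ^ 2 / 4))
  have hs : (1 : ℝ) ≤ (n : ℝ) / 2 := by
    have : (2 : ℝ) ≤ n := by exact_mod_cast hn
    linarith
  have hpos : 0 < Real.Gamma ((m : ℝ) + (n : ℝ) / 2) := Real.Gamma_pos_of_pos (by positivity)
  rw [div_eq_mul_inv]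
  refine mul_le_mul_of_nonneg_left ?_ (by positivity)
  rw [div_le_iff₀ (by positivity), inv_mul_cancel_left₀ (by positivity)]
  exact gamma_le_gamma_natCast_add hs m

lemma psi_nonneg (n : ℕ) (t : ℝ) : 0 ≤ psi n t :=
  inv_nonneg.2 (tsum_nonneg (psi_term_nonneg n t))

lemma psi_le {n : ℕ} (hn : 2 ≤ n) {t : ℝ} (ht : 0 < t) : psi n t ≤ (t ^ 2 / (2 * n))⁻¹ := by
  have hn0 : (0 : ℝ) < n := by exact_mod_cast (by omega : 0 < n)
  refine inv_anti₀ (by positivity) ?_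
  refine le_trans (le_of_eq ?_)
    ((summable_psi_term hn t).le_tsum 1 fun m _ ↦ psi_term_nonneg n t m)
  have hG : Real.Gamma ((n : ℝ) / 2) ≠ 0 := (Real.Gamma_pos_of_pos (by positivity)).ne'
  rw [Nat.cast_one, add_comm (1 : ℝ), Real.Gamma_add_one (by positivity)]
  simp only [pow_one, Nat.factorial_one, Nat.cast_one, one_mul]
  field_simp
  norm_num

lemma tendsto_psi_atTop {n : ℕ} (hn : 2 ≤ n) :
    Filter.Tendsto (psi n) Filter.atTop (nhds 0) := by
  have hn0 : (0 : ℝ) < 2 * n := by exact_mod_cast (by omega : 0 < 2 * n)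
  refine squeeze_zero' (Filter.Eventually.of_forall (psi_nonneg n))
    ((Filter.eventually_gt_atTop 0).mono fun t ht ↦ psi_le hn ht) ?_
  exact ((Filter.tendsto_pow_atTop two_ne_zero).atTop_div_const hn0).inv_tendsto_atTop

lemma sphereUniform_univ_le_one (n : ℕ) (x : EuclideanSpace ℝ (Fin n)) (r : ℝ) :
    sphereUniform n x r univ ≤ 1 := by
  simp only [sphereUniform, Measure.smul_apply, Measure.restrict_apply_univ, smul_eq_mul]
  exact ENNReal.inv_mul_le_one _

lemma abs_integral_sphereUniform_le {n : ℕ} {u : EuclideanSpace ℝ (Fin n) → ℝ} {C : ℝ}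
    (hC : ∀ x, |u x| ≤ C) (x : EuclideanSpace ℝ (Fin n)) (r : ℝ) :
    |∫ y, u y ∂(sphereUniform n x r)| ≤ C := by
  have hmass := sphereUniform_univ_le_one n x r
  have : IsFiniteMeasure (sphereUniform n x r) := ⟨hmass.trans_lt ENNReal.one_lt_top⟩
  refine (norm_integral_le_of_norm_le_const (f := u) (Filter.Eventually.of_forall hC)).trans ?_
  refine mul_le_of_le_one_right ((abs_nonneg _).trans (hC x)) ?_
  exact ENNReal.toReal_le_of_le_ofReal zero_le_one (by simpa using hmass)

/-- Let `n ≥ 2` and `μ > 0`, and let `u : ℝⁿ → ℝ` be a bounded continuous function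
satisfying the average property `u(x) = ψ_n(μr) ∫_{∂B(x,r)} u dσ` for every `x ∈ ℝⁿ`
and every `r > 0`.  Then `u` is constant. -/
theorem liouville_average_property (n : ℕ) (hn : 2 ≤ n) (μ : ℝ) (hμ : 0 < μ)
    (u : EuclideanSpace ℝ (Fin n) → ℝ)
    (hu : Continuous u)
    (hbdd : ∃ C : ℝ, ∀ x, |u x| ≤ C)
    (havg : ∀ (x : EuclideanSpace ℝ (Fin n)) (r : ℝ), 0 < r →
      u x = psi n (μ * r) * ∫ y, u y ∂(sphereUniform n x r)) :
    ∀ x y, u x = u y := by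
  obtain ⟨C, hC⟩ := hbdd
  suffices hzero : ∀ x, u x = 0 from fun x y ↦ (hzero x).trans (hzero y).symm
  intro x
  have hlim : Filter.Tendsto (fun r ↦ psi n (μ * r) * C) Filter.atTop (nhds 0) := by
    simpa using ((tendsto_psi_atTop hn).comp
      (Filter.tendsto_id.const_mul_atTop hμ)).mul_const C
  refine abs_nonpos_iff.1 (ge_of_tendsto hlim ((Filter.eventually_gt_atTop 0).mono fun r hr ↦ ?_))
  rw [havg x r hr, abs_mul, abs_of_nonneg (psi_nonneg n _)]
  exact mul_le_mul_of_nonneg_left (abs_integral_sphereUniform_le hC x r) (psi_nonneg n _)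

end
end
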